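/- For the KKM potential V_I, the derived brackets C₁ = {A₁,B₁}, C₂ = {A₂,B₂}, D = {B₁,B₂} close quadratically on the integrals: {C₁,C₂} = −8A₂C₁ + 8A₁C₂ + 16δD, {C₁,D} = 8(F − B₁ − B₂)C₁ − 8(2α₁ + B₁)C₂ − 8A₁D, and {C₂,D} = 8(B₂ + 2α₃)C₁ + 8(B₁ + B₂ − F)C₂ − 8A₂D. -/

import Mathlib

noncomputable section

open MvPolynomial

/-- The field of rational functions over ℝ in the six variables
`x, y, z, p_x, p_y, p_z`: the fraction field of the polynomial ring. -/
abbrev K6 : Type := FractionRing (MvPolynomial (Fin 6) ℝ)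

/-- The canonical embedding of the polynomial ring into its fraction field. -/
def toK6 : MvPolynomial (Fin 6) ℝ →+* K6 :=
  algebraMap (MvPolynomial (Fin 6) ℝ) K6

/-- Constants, embedded in `K6`. -/
def cR (a : ℝ) : K6 := toK6 (MvPolynomial.C a)

def vx : K6 := toK6 (MvPolynomial.X 0)
def vy : K6 := toK6 (MvPolynomial.X 1)
def vz : K6 := toK6 (MvPolynomial.X 2)
def vpx : K6 := toK6 (MvPolynomial.X 3)
def vpy : K6 := toK6 (MvPolynomial.X 4)
def vpz : K6 := toK6 (MvPolynomial.X 5)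

/-- `D` is the (unique) extension to the fraction field of the formal partial
derivative `pderiv j` on the polynomial ring: an additive map satisfying the
Leibniz rule which agrees with `pderiv j` on polynomials. -/
def IsPDeriv (j : Fin 6) (D : K6 → K6) : Prop :=
  (∀ f g : K6, D (f + g) = D f + D g) ∧
  (∀ f g : K6, D (f * g) = D f * g + f * D g) ∧
  (∀ p, D (toK6 p) = toK6 (pderiv j p))

/-- The canonical Poisson bracket on `K6`, where `Pd 0, …, Pd 5` are the
partial derivatives with respect to `x, y, z, p_x, p_y, p_z` respectively:
`{f,g} = f_x g_{p_x} + f_y g_{p_y} + f_z g_{p_z}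
  - f_{p_x} g_x - f_{p_y} g_y - f_{p_z} g_z`. -/
def poisson (Pd : Fin 6 → K6 → K6) (f g : K6) : K6 :=
  Pd 0 f * Pd 3 g + Pd 1 f * Pd 4 g + Pd 2 f * Pd 5 g
    - Pd 3 f * Pd 0 g - Pd 4 f * Pd 1 g - Pd 5 f * Pd 2 g

/-- Angular momentum `J_x = y p_z - z p_y`. -/
def Jx : K6 := vy * vpz - vz * vpy
/-- Angular momentum `J_y = z p_x - x p_z`. -/
def Jy : K6 := vz * vpx - vx * vpz
/-- Angular momentum `J_z = x p_y - y p_x`. -/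
def Jz : K6 := vx * vpy - vy * vpx
/-- Total angular momentum squared `J² = J_x² + J_y² + J_z²`. -/
def Jsq : K6 := Jx ^ 2 + Jy ^ 2 + Jz ^ 2

/-- KKM V_I Hamiltonian. -/
def HV (α₁ α₂ α₃ δ : ℝ) : K6 :=
  vpx ^ 2 + vpy ^ 2 + vpz ^ 2 + cR δ * (vx ^ 2 + vy ^ 2 + vz ^ 2)
    + cR α₁ / vx ^ 2 + cR α₂ / vy ^ 2 + cR α₃ / vz ^ 2

def A1V (α₁ δ : ℝ) : K6 := vpx ^ 2 + cR δ * vx ^ 2 + cR α₁ / vx ^ 2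

def A2V (α₃ δ : ℝ) : K6 := vpz ^ 2 + cR δ * vz ^ 2 + cR α₃ / vz ^ 2

def B1V (α₁ α₂ : ℝ) : K6 :=
  Jz ^ 2 + cR α₂ * vx ^ 2 / vy ^ 2 + cR α₁ * vy ^ 2 / vx ^ 2

def B2V (α₂ α₃ : ℝ) : K6 :=
  Jx ^ 2 + cR α₃ * vy ^ 2 / vz ^ 2 + cR α₂ * vz ^ 2 / vy ^ 2

def FV (α₁ α₂ α₃ : ℝ) : K6 :=
  Jsq + cR α₂ * (vx ^ 2 + vz ^ 2) / vy ^ 2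
    + (cR α₃ * vx ^ 2 * (vx ^ 2 + vy ^ 2) + cR α₁ * vz ^ 2 * (vy ^ 2 + vz ^ 2))
      / (vx ^ 2 * vz ^ 2)

namespace KKMVI

section Abstract

variable {K : Type*} [Field K]

/-- The canonical Poisson bracket built from six derivations of a field. -/
def bracket (D : Fin 6 → Derivation ℤ K K) (f g : K) : K :=
  D 0 f * D 3 g + D 1 f * D 4 g + D 2 f * D 5 g
    - D 3 f * D 0 g - D 4 f * D 1 g - D 5 f * D 2 g

/-- An additive map satisfying the Leibniz rule, as a derivation over `ℤ`. -/
def derivationOfLeibniz (f : K → K) (hadd : ∀ u v, f (u + v) = f u + f v)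
    (hmul : ∀ u v, f (u * v) = f u * v + u * f v) : Derivation ℤ K K :=
  Derivation.mk' (AddMonoidHom.mk' f hadd).toIntLinearMap fun u v => by
    simp [hmul, add_comm, mul_comm]

/-- The elements `x, y, z, p, q, r` are dual coordinates for the derivations `D`, and
`a, b, c, d` are constants. -/
structure IsCanonical (D : Fin 6 → Derivation ℤ K K) (x y z p q r a b c d : K) : Prop where
  coord : ∀ i j, D i (![x, y, z, p, q, r] j) = if i = j then 1 else 0
  const : ∀ i j, D i (![a, b, c, d] j) = 0

/-- The partial derivatives of a function, as a vector. -/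
def grad (D : Fin 6 → Derivation ℤ K K) (f : K) : Fin 6 → K := fun i => D i f

/-- The integral `A₁`, in coordinates. -/
def A₁ (x p a d : K) : K :=
  p ^ 2 + d * x ^ 2 + a / x ^ 2

/-- The integral `A₂`, in coordinates. -/
def A₂ (z r c d : K) : K :=
  r ^ 2 + d * z ^ 2 + c / z ^ 2

/-- The integral `B₁`, in coordinates. -/
def B₁ (x y p q a b : K) : K :=
  (x * q - y * p) ^ 2 + b * x ^ 2 / y ^ 2 + a * y ^ 2 / x ^ 2

/-- The integral `B₂`, in coordinates. -/
def B₂ (y z q r b c : K) : K :=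
  (y * r - z * q) ^ 2 + c * y ^ 2 / z ^ 2 + b * z ^ 2 / y ^ 2

/-- Closed form of `{A₁, B₁}`. -/
def C₁ (x y p q a b d : K) : K :=
  -4 * y * (x * q - y * p) * (d * x - a / x ^ 3)
      - 4 * p * ((x * q - y * p) * q + b * x / y ^ 2 - a * y ^ 2 / x ^ 3)

/-- Closed form of `{A₂, B₂}`. -/
def C₂ (y z q r b c d : K) : K :=
  4 * y * (y * r - z * q) * (d * z - c / z ^ 3)
      + 4 * r * ((y * r - z * q) * q + c * y ^ 2 / z ^ 3 - b * z / y ^ 2)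

/-- Closed form of `{B₁, B₂}`. -/
def E (x y z p q r a b c : K) : K :=
  4 * z * (y * r - z * q) * ((x * q - y * p) * p + b * x ^ 2 / y ^ 3 - a * y / x ^ 2)
      - 4 * x * (x * q - y * p) * ((y * r - z * q) * r + c * y / z ^ 2 - b * z ^ 2 / y ^ 3)

/-- The integral `F`, in coordinates. -/
def F (x y z p q r a b c : K) : K :=
  (y * r - z * q) ^ 2 + (z * p - x * r) ^ 2 + (x * q - y * p) ^ 2 + b * (x ^ 2 + z ^ 2) / y ^ 2
    + (c * x ^ 2 * (x ^ 2 + y ^ 2) + a * z ^ 2 * (y ^ 2 + z ^ 2)) / (x ^ 2 * z ^ 2)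

variable {D : Fin 6 → Derivation ℤ K K} {x y z p q r a b c d : K}

theorem bracket_eq_of_grad {f g : K} {u v : Fin 6 → K} (hf : grad D f = u) (hg : grad D g = v) :
    bracket D f g = u 0 * v 3 + u 1 * v 4 + u 2 * v 5 - u 3 * v 0 - u 4 * v 1 - u 5 * v 2 := by
  subst hf hg
  rfl

theorem grad_add (f g : K) : grad D (f + g) = grad D f + grad D g := by
  ext i
  simp [grad]

theorem grad_sub (f g : K) : grad D (f - g) = grad D f - grad D g := by
  ext i
  simp [grad]

theorem grad_neg (f : K) : grad D (-f) = -grad D f := by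
  ext i
  simp [grad]

theorem grad_mul (f g : K) : grad D (f * g) = g • grad D f + f • grad D g := by
  ext i
  simp [grad, add_comm]

theorem grad_pow (f : K) (n : ℕ) : grad D (f ^ n) = (n * f ^ (n - 1)) • grad D f := by
  ext i
  simp [grad, Derivation.leibniz_pow, mul_assoc]

theorem grad_div (f g : K) :
    grad D (f / g) = (g⁻¹) • grad D f - (f / g ^ 2) • grad D g := by
  ext i
  rcases eq_or_ne g 0 with rfl | hg
  · simp [grad]
  · simp only [grad, Derivation.leibniz_div, Pi.sub_apply, Pi.smul_apply, smul_eq_mul]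
    field_simp

theorem grad_ofNat (n : ℕ) [n.AtLeastTwo] : grad D (ofNat(n) : K) = 0 := by
  ext i
  exact (D i).map_natCast n

namespace IsCanonical

theorem grad_x (h : IsCanonical D x y z p q r a b c d) : grad D x = ![1, 0, 0, 0, 0, 0] := by
  ext i
  have := h.coord i 0
  fin_cases i <;> simpa [grad] using this

theorem grad_y (h : IsCanonical D x y z p q r a b c d) : grad D y = ![0, 1, 0, 0, 0, 0] := by
  ext i
  have := h.coord i 1
  fin_cases i <;> simpa [grad] using this

theorem grad_z (h : IsCanonical D x y z p q r a b c d) : grad D z = ![0, 0, 1, 0, 0, 0] := by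
  ext i
  have := h.coord i 2
  fin_cases i <;> simpa [grad] using this

theorem grad_p (h : IsCanonical D x y z p q r a b c d) : grad D p = ![0, 0, 0, 1, 0, 0] := by
  ext i
  have := h.coord i 3
  fin_cases i <;> simpa [grad] using this

theorem grad_q (h : IsCanonical D x y z p q r a b c d) : grad D q = ![0, 0, 0, 0, 1, 0] := by
  ext i
  have := h.coord i 4
  fin_cases i <;> simpa [grad] using this

theorem grad_r (h : IsCanonical D x y z p q r a b c d) : grad D r = ![0, 0, 0, 0, 0, 1] := by
  ext i
  have := h.coord i 5
  fin_cases i <;> simpa [grad] using this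

theorem grad_a (h : IsCanonical D x y z p q r a b c d) : grad D a = 0 := funext (h.const · 0)

theorem grad_b (h : IsCanonical D x y z p q r a b c d) : grad D b = 0 := funext (h.const · 1)

theorem grad_c (h : IsCanonical D x y z p q r a b c d) : grad D c = 0 := funext (h.const · 2)

theorem grad_d (h : IsCanonical D x y z p q r a b c d) : grad D d = 0 := funext (h.const · 3)

theorem grad_A₁ (h : IsCanonical D x y z p q r a b c d) (hx : x ≠ 0) :
    grad D (A₁ x p a d) =
      ![2 * d * x - 2 * a / x ^ 3, 0, 0, 2 * p, 0, 0] := by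
  simp only [A₁, grad_add, grad_mul, grad_pow, grad_div, h.grad_x, h.grad_p, h.grad_a,
    h.grad_d]
  ext i
  fin_cases i <;> simp
  field_simp
  ring

theorem grad_A₂ (h : IsCanonical D x y z p q r a b c d) (hz : z ≠ 0) :
    grad D (A₂ z r c d) =
      ![0, 0, 2 * d * z - 2 * c / z ^ 3, 0, 0, 2 * r] := by
  simp only [A₂, grad_add, grad_mul, grad_pow, grad_div, h.grad_z, h.grad_r, h.grad_c,
    h.grad_d]
  ext i
  fin_cases i <;> simp
  field_simp
  ring

theorem grad_B₁ (h : IsCanonical D x y z p q r a b c d) (hx : x ≠ 0) (hy : y ≠ 0) :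
    grad D (B₁ x y p q a b) =
      ![2 * (x * q - y * p) * q + 2 * b * x / y ^ 2 - 2 * a * y ^ 2 / x ^ 3,
        -2 * (x * q - y * p) * p - 2 * b * x ^ 2 / y ^ 3 + 2 * a * y / x ^ 2,
        0,
        -2 * y * (x * q - y * p),
        2 * x * (x * q - y * p),
        0] := by
  simp only [B₁, grad_add, grad_sub, grad_mul, grad_pow, grad_div, h.grad_x, h.grad_y,
    h.grad_p, h.grad_q, h.grad_a, h.grad_b]
  ext i
  fin_cases i <;> simp <;> field_simp <;> ring

theorem grad_B₂ (h : IsCanonical D x y z p q r a b c d) (hy : y ≠ 0)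
    (hz : z ≠ 0) :
    grad D (B₂ y z q r b c) =
      ![0,
        2 * (y * r - z * q) * r + 2 * c * y / z ^ 2 - 2 * b * z ^ 2 / y ^ 3,
        -2 * (y * r - z * q) * q - 2 * c * y ^ 2 / z ^ 3 + 2 * b * z / y ^ 2,
        0,
        -2 * z * (y * r - z * q),
        2 * y * (y * r - z * q)] := by
  simp only [B₂, grad_add, grad_sub, grad_mul, grad_pow, grad_div, h.grad_y, h.grad_z,
    h.grad_q, h.grad_r, h.grad_b, h.grad_c]
  ext i
  fin_cases i <;> simp <;> field_simp <;> ring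

theorem grad_C₁ (h : IsCanonical D x y z p q r a b c d) (hx : x ≠ 0) (hy : y ≠ 0) :
    grad D (C₁ x y p q a b d) =
      ![-4 * y * q * (d * x - a / x ^ 3) - 4 * y * (x * q - y * p) * (d + 3 * a / x ^ 4)
            - 4 * p * (q ^ 2 + b / y ^ 2 + 3 * a * y ^ 2 / x ^ 4),
        -4 * (x * q - 2 * y * p) * (d * x - a / x ^ 3)
            + 4 * p * (p * q + 2 * b * x / y ^ 3 + 2 * a * y / x ^ 3),
        0,
        4 * y ^ 2 * (d * x - a / x ^ 3)
            - 4 * ((x * q - 2 * y * p) * q + b * x / y ^ 2 - a * y ^ 2 / x ^ 3),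
        -4 * x * y * (d * x - a / x ^ 3) - 4 * p * (2 * x * q - y * p),
        0] := by
  simp only [C₁, grad_add, grad_sub, grad_neg, grad_mul, grad_pow, grad_div, grad_ofNat,
    h.grad_x, h.grad_y, h.grad_p, h.grad_q, h.grad_a, h.grad_b, h.grad_d]
  ext i
  fin_cases i <;> simp <;> field_simp <;> ring

theorem grad_C₂ (h : IsCanonical D x y z p q r a b c d) (hy : y ≠ 0)
    (hz : z ≠ 0) :
    grad D (C₂ y z q r b c d) =
      ![0,
        4 * (2 * y * r - z * q) * (d * z - c / z ^ 3)
            + 4 * r * (r * q + 2 * c * y / z ^ 3 + 2 * b * z / y ^ 3),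
        -4 * y * q * (d * z - c / z ^ 3) + 4 * y * (y * r - z * q) * (d + 3 * c / z ^ 4)
            - 4 * r * (q ^ 2 + 3 * c * y ^ 2 / z ^ 4 + b / y ^ 2),
        0,
        -4 * y * z * (d * z - c / z ^ 3) + 4 * r * (y * r - 2 * z * q),
        4 * y ^ 2 * (d * z - c / z ^ 3)
            + 4 * ((2 * y * r - z * q) * q + c * y ^ 2 / z ^ 3 - b * z / y ^ 2)] := by
  simp only [C₂, grad_add, grad_sub, grad_mul, grad_pow, grad_div, grad_ofNat, h.grad_y,
    h.grad_z, h.grad_q, h.grad_r, h.grad_b, h.grad_c, h.grad_d]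
  ext i
  fin_cases i <;> simp <;> field_simp <;> ring

theorem grad_E (h : IsCanonical D x y z p q r a b c d) (hx : x ≠ 0) (hy : y ≠ 0)
    (hz : z ≠ 0) :
    grad D (E x y z p q r a b c) =
      ![4 * z * (y * r - z * q) * (q * p + 2 * b * x / y ^ 3 + 2 * a * y / x ^ 3)
            - 4 * (2 * x * q - y * p) * ((y * r - z * q) * r + c * y / z ^ 2 - b * z ^ 2 / y ^ 3),
        4 * z * r * ((x * q - y * p) * p + b * x ^ 2 / y ^ 3 - a * y / x ^ 2)
            + 4 * z * (y * r - z * q) * (-p ^ 2 - 3 * b * x ^ 2 / y ^ 4 - a / x ^ 2)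
            + 4 * x * p * ((y * r - z * q) * r + c * y / z ^ 2 - b * z ^ 2 / y ^ 3)
            - 4 * x * (x * q - y * p) * (r ^ 2 + c / z ^ 2 + 3 * b * z ^ 2 / y ^ 4),
        4 * (y * r - 2 * z * q) * ((x * q - y * p) * p + b * x ^ 2 / y ^ 3 - a * y / x ^ 2)
            + 4 * x * (x * q - y * p) * (q * r + 2 * c * y / z ^ 3 + 2 * b * z / y ^ 3),
        4 * z * (y * r - z * q) * (x * q - 2 * y * p)
            + 4 * x * y * ((y * r - z * q) * r + c * y / z ^ 2 - b * z ^ 2 / y ^ 3),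
        -4 * z ^ 2 * ((x * q - y * p) * p + b * x ^ 2 / y ^ 3 - a * y / x ^ 2)
            + 4 * z * (y * r - z * q) * x * p
            - 4 * x ^ 2 * ((y * r - z * q) * r + c * y / z ^ 2 - b * z ^ 2 / y ^ 3)
            + 4 * x * (x * q - y * p) * z * r,
        4 * z * y * ((x * q - y * p) * p + b * x ^ 2 / y ^ 3 - a * y / x ^ 2)
            - 4 * x * (x * q - y * p) * (2 * y * r - z * q)] := by
  simp only [E, grad_add, grad_sub, grad_mul, grad_pow, grad_div, grad_ofNat, h.grad_x,
    h.grad_y, h.grad_z, h.grad_p, h.grad_q, h.grad_r, h.grad_a, h.grad_b, h.grad_c]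
  ext i
  fin_cases i <;> simp <;> field_simp <;> ring

end IsCanonical

theorem bracket_A₁_B₁ (h : IsCanonical D x y z p q r a b c d) (hx : x ≠ 0) (hy : y ≠ 0) :
    bracket D (A₁ x p a d) (B₁ x y p q a b) =
      C₁ x y p q a b d := by
  rw [bracket_eq_of_grad (h.grad_A₁ hx) (h.grad_B₁ hx hy)]
  simp [C₁]
  field_simp
  ring

theorem bracket_A₂_B₂ (h : IsCanonical D x y z p q r a b c d) (hy : y ≠ 0)
    (hz : z ≠ 0) :
    bracket D (A₂ z r c d) (B₂ y z q r b c) =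
      C₂ y z q r b c d := by
  rw [bracket_eq_of_grad (h.grad_A₂ hz) (h.grad_B₂ hy hz)]
  simp [C₂]
  field_simp
  ring

theorem bracket_B₁_B₂ (h : IsCanonical D x y z p q r a b c d) (hx : x ≠ 0) (hy : y ≠ 0)
    (hz : z ≠ 0) :
    bracket D (B₁ x y p q a b) (B₂ y z q r b c) =
      E x y z p q r a b c := by
  rw [bracket_eq_of_grad (h.grad_B₁ hx hy) (h.grad_B₂ hy hz)]
  simp [E]
  field_simp
  ring

theorem bracket_C₁_C₂ (h : IsCanonical D x y z p q r a b c d) (hx : x ≠ 0) (hy : y ≠ 0)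
    (hz : z ≠ 0) :
    bracket D (C₁ x y p q a b d) (C₂ y z q r b c d) =
      -8 * A₂ z r c d * C₁ x y p q a b d + 8 * A₁ x p a d * C₂ y z q r b c d
          + 16 * d * E x y z p q r a b c := by
  rw [bracket_eq_of_grad (h.grad_C₁ hx hy) (h.grad_C₂ hy hz)]
  simp [A₁, A₂, C₁, C₂, E]
  field_simp
  ring

theorem bracket_C₁_E (h : IsCanonical D x y z p q r a b c d) (hx : x ≠ 0) (hy : y ≠ 0)
    (hz : z ≠ 0) :
    bracket D (C₁ x y p q a b d) (E x y z p q r a b c) =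
      8 * (F x y z p q r a b c - B₁ x y p q a b - B₂ y z q r b c) * C₁ x y p q a b d
          - 8 * (2 * a + B₁ x y p q a b) * C₂ y z q r b c d - 8 * A₁ x p a d * E x y z p q r a b c := by
  rw [bracket_eq_of_grad (h.grad_C₁ hx hy) (h.grad_E hx hy hz)]
  simp [A₁, B₁, B₂, C₁, C₂, E, F]
  field_simp
  ring

theorem bracket_C₂_E (h : IsCanonical D x y z p q r a b c d) (hx : x ≠ 0) (hy : y ≠ 0)
    (hz : z ≠ 0) :
    bracket D (C₂ y z q r b c d) (E x y z p q r a b c) =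
      8 * (B₂ y z q r b c + 2 * c) * C₁ x y p q a b d
          + 8 * (B₁ x y p q a b + B₂ y z q r b c - F x y z p q r a b c) * C₂ y z q r b c d
          - 8 * A₂ z r c d * E x y z p q r a b c := by
  rw [bracket_eq_of_grad (h.grad_C₂ hy hz) (h.grad_E hx hy hz)]
  simp [A₂, B₁, B₂, C₁, C₂, E, F]
  field_simp
  ring

end Abstract

/-- The derivations of `K6` given by extensions of the partial derivatives. -/
def toDerivation {Pd : Fin 6 → K6 → K6} (hPd : ∀ j, IsPDeriv j (Pd j)) (j : Fin 6) :=
  derivationOfLeibniz (Pd j) (hPd j).1 (hPd j).2.1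

theorem toDerivation_apply {Pd : Fin 6 → K6 → K6} (hPd : ∀ j, IsPDeriv j (Pd j)) (j : Fin 6)
    (f : K6) : toDerivation hPd j f = Pd j f := rfl

theorem isCanonical_toDerivation {Pd : Fin 6 → K6 → K6} (hPd : ∀ j, IsPDeriv j (Pd j))
    (a b c d : ℝ) :
    IsCanonical (toDerivation hPd) vx vy vz vpx vpy vpz (cR a) (cR b) (cR c) (cR d)
    where
  coord i j := by
    have key (k : Fin 6) : toDerivation hPd i (toK6 (X k)) = if i = k then 1 else 0 := by
      rw [toDerivation_apply, (hPd i).2.2, pderiv_X, Pi.single_apply]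
      simp only [eq_comm (a := k)]
      split_ifs <;> simp
    fin_cases j
    exacts [key 0, key 1, key 2, key 3, key 4, key 5]
  const i j := by
    have key (t : ℝ) : toDerivation hPd i (toK6 (C t)) = 0 := by
      rw [toDerivation_apply, (hPd i).2.2, pderiv_C, map_zero]
    fin_cases j
    exacts [key a, key b, key c, key d]

theorem toK6_X_ne_zero (k : Fin 6) : toK6 (X k) ≠ 0 :=
  (map_ne_zero_iff _ (IsFractionRing.injective (MvPolynomial (Fin 6) ℝ) K6)).mpr (X_ne_zero k)

theorem poisson_eq_bracket {Pd : Fin 6 → K6 → K6} (hPd : ∀ j, IsPDeriv j (Pd j)) :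
    poisson Pd = bracket (toDerivation hPd) := rfl

end KKMVI

open KKMVI in
theorem kkm_VI_second_algebra (α₁ α₂ α₃ δ : ℝ) (Pd : Fin 6 → K6 → K6)
    (hPd : ∀ j, IsPDeriv j (Pd j))
    (H A1 A2 B1 B2 F : K6)
    (hH : H = HV α₁ α₂ α₃ δ) (hA1 : A1 = A1V α₁ δ) (hA2 : A2 = A2V α₃ δ)
    (hB1 : B1 = B1V α₁ α₂) (hB2 : B2 = B2V α₂ α₃) (hF : F = FV α₁ α₂ α₃)
    (C1 C2 Dv : K6) (hC1 : C1 = poisson Pd A1 B1) (hC2 : C2 = poisson Pd A2 B2)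
    (hDv : Dv = poisson Pd B1 B2) :
    poisson Pd C1 C2 = -8 * A2 * C1 + 8 * A1 * C2 + 16 * cR δ * Dv ∧
    poisson Pd C1 Dv =
      8 * (F - B1 - B2) * C1 - 8 * (2 * cR α₁ + B1) * C2 - 8 * A1 * Dv ∧
    poisson Pd C2 Dv =
      8 * (B2 + 2 * cR α₃) * C1 + 8 * (B1 + B2 - F) * C2 - 8 * A2 * Dv := by
  have h := isCanonical_toDerivation hPd α₁ α₂ α₃ δ
  have hx : vx ≠ 0 := toK6_X_ne_zero 0
  have hy : vy ≠ 0 := toK6_X_ne_zero 1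
  have hz : vz ≠ 0 := toK6_X_ne_zero 2
  have hA1_coord : A1 = A₁ vx vpx (cR α₁) (cR δ) := hA1
  have hA2_coord : A2 = A₂ vz vpz (cR α₃) (cR δ) := hA2
  have hB1_coord : B1 = B₁ vx vy vpx vpy (cR α₁) (cR α₂) := hB1
  have hB2_coord : B2 = B₂ vy vz vpy vpz (cR α₂) (cR α₃) := hB2
  have hF_coord : F = KKMVI.F vx vy vz vpx vpy vpz (cR α₁) (cR α₂) (cR α₃) := hF
  rw [poisson_eq_bracket hPd] at hC1 hC2 hDv ⊢
  rw [hA1_coord, hB1_coord, bracket_A₁_B₁ h hx hy] at hC1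
  rw [hA2_coord, hB2_coord, bracket_A₂_B₂ h hy hz] at hC2
  rw [hB1_coord, hB2_coord, bracket_B₁_B₂ h hx hy hz] at hDv
  rw [hA1_coord, hA2_coord, hB1_coord, hB2_coord, hF_coord, hC1, hC2, hDv]
  exact ⟨bracket_C₁_C₂ h hx hy hz, bracket_C₁_E h hx hy hz, bracket_C₂_E h hx hy hz⟩
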